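/- Let G : V × ⋯ × V → K be an n-linear form (n ≥ 2) over a field K and let τ : V → V be a G-selfadjoint linear mapping. If V = V₁ ⊕ ⋯ ⊕ V_s is a decomposition of V into a direct sum of τ-invariant subspaces such that for all i ≠ j the restrictions τ|V_i and τ|V_j have no common eigenvalues in an algebraic closure of K (equivalently, their minimal polynomials are coprime), then G = G₁ ⊕ ⋯ ⊕ G_s, where G_i is the restriction of G to V_i; that is, G(v₁,…,vₙ) = 0 whenever each v_k lies in some subspace V_{i_k} and not all the indices i₁,…,iₙ are equal. -/

import Mathlib

section Defs

variable {K : Type*} [Field K] {n : ℕ}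

/-- The restriction of a multilinear form to a submodule. -/
def formRestrict {U : Type*} [AddCommGroup U] [Module K U]
    (F : MultilinearMap K (fun _ : Fin n => U) K) (W : Submodule K U) :
    MultilinearMap K (fun _ : Fin n => W) K :=
  F.compLinearMap fun _ => W.subtype

/-- Two multilinear forms are congruent if a single linear bijection carries one to the other. -/
def FormCongruent {U V : Type*} [AddCommGroup U] [Module K U] [AddCommGroup V] [Module K V]
    (F : MultilinearMap K (fun _ : Fin n => U) K)
    (G : MultilinearMap K (fun _ : Fin n => V) K) : Prop :=
  ∃ φ : U ≃ₗ[K] V, ∀ u : Fin n → U, F u = G fun i => φ (u i)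

/-- Symmetric equivalence of multilinear forms. -/
def FormSymmEquiv {U V : Type*} [AddCommGroup U] [Module K U] [AddCommGroup V] [Module K V]
    (F : MultilinearMap K (fun _ : Fin n => U) K)
    (G : MultilinearMap K (fun _ : Fin n => V) K) : Prop :=
  ∃ φ : Fin n → U ≃ₗ[K] V, ∀ (σ : Equiv.Perm (Fin n)) (u : Fin n → U),
    F u = G fun i => φ (σ i) (u i)

/-- `W` is a direct-sum decomposition of the underlying space for which `F` vanishes on
mixed tuples, i.e. `F = ⨁ᵢ F|Wᵢ`. -/
def IsDecompFamily {U : Type*} [AddCommGroup U] [Module K U] {ι : Type*} [DecidableEq ι]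
    (F : MultilinearMap K (fun _ : Fin n => U) K) (W : ι → Submodule K U) : Prop :=
  DirectSum.IsInternal W ∧
    ∀ (x : Fin n → U) (k l : Fin n) (i j : ι), i ≠ j → x k ∈ W i → x l ∈ W j → F x = 0

/-- A multilinear form is indecomposable if in every direct-sum decomposition one of the
two subspaces is zero. -/
def FormIndecomposable {U : Type*} [AddCommGroup U] [Module K U]
    (F : MultilinearMap K (fun _ : Fin n => U) K) : Prop :=
  ∀ W₁ W₂ : Submodule K U, IsCompl W₁ W₂ →
    (∀ (x : Fin n → U) (k l : Fin n), x k ∈ W₁ → x l ∈ W₂ → F x = 0) →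
    W₁ = ⊥ ∨ W₂ = ⊥

/-- A multilinear form has no zero direct summands if in every direct-sum decomposition the
summand that is the zero form corresponds to the zero subspace. -/
def FormNoZeroSummand {U : Type*} [AddCommGroup U] [Module K U]
    (F : MultilinearMap K (fun _ : Fin n => U) K) : Prop :=
  ∀ W₁ W₂ : Submodule K U, IsCompl W₁ W₂ →
    (∀ (x : Fin n → U) (k l : Fin n), x k ∈ W₁ → x l ∈ W₂ → F x = 0) →
    (∀ x : Fin n → U, (∀ k, x k ∈ W₂) → F x = 0) → W₂ = ⊥

/-- A linear map `τ` is `G`-selfadjoint if applying `τ` in any one argument of `G`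
gives the same value regardless of the argument chosen. -/
def FormSelfAdjoint {V : Type*} [AddCommGroup V] [Module K V]
    (G : MultilinearMap K (fun _ : Fin n => V) K) (τ : V →ₗ[K] V) : Prop :=
  ∀ (v : Fin n → V) (i j : Fin n),
    G (Function.update v i (τ (v i))) = G (Function.update v j (τ (v j)))

end Defs

namespace FormSelfAdjoint

variable {K : Type*} [Field K] {n : ℕ} {V : Type*} [AddCommGroup V] [Module K V]
  {G : MultilinearMap K (fun _ : Fin n => V) K} {σ τ : Module.End K V}

theorem add (hσ : FormSelfAdjoint G σ) (hτ : FormSelfAdjoint G τ) :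
    FormSelfAdjoint G (σ + τ) := by
  intro v i j
  simp only [LinearMap.add_apply, MultilinearMap.map_update_add, hσ v i j, hτ v i j]

theorem algebraMap (a : K) : FormSelfAdjoint G (algebraMap K (Module.End K V) a) := by
  intro v i j
  simp only [Module.algebraMap_end_apply, MultilinearMap.map_update_smul,
    Function.update_eq_self]

theorem mul (hσ : FormSelfAdjoint G σ) (hτ : FormSelfAdjoint G τ) (h : Commute σ τ) :
    FormSelfAdjoint G (σ * τ) := by
  intro v i j
  obtain rfl | hij := eq_or_ne i j
  · rfl
  have h₁ := hσ (Function.update v i (τ (v i))) i j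
  have h₂ := hτ (Function.update v j (σ (v j))) i j
  rw [Function.update_self, Function.update_idem, Function.update_of_ne hij.symm] at h₁
  rw [Function.update_self, Function.update_idem, Function.update_of_ne hij,
    Function.update_comm hij.symm] at h₂
  rw [Module.End.mul_apply, h₁, h₂, h.eq, Module.End.mul_apply]

/-- A polynomial in a selfadjoint map is selfadjoint. -/
theorem aeval (hτ : FormSelfAdjoint G τ) (p : Polynomial K) :
    FormSelfAdjoint G (Polynomial.aeval τ p) := by
  induction p using Polynomial.induction_on with
  | C a => simpa using algebraMap a
  | add p q hp hq => simpa using hp.add hq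
  | monomial m a ih =>
    rw [pow_succ, ← mul_assoc, map_mul, Polynomial.aeval_X]
    refine ih.mul hτ ?_
    have h := (Commute.all (Polynomial.C a * Polynomial.X ^ m) Polynomial.X).map
      (Polynomial.aeval (R := K) τ)
    rwa [Polynomial.aeval_X] at h

/-- A form vanishes on a tuple if two of its entries are annihilated by coprime polynomials in a
selfadjoint map. -/
theorem apply_eq_zero_of_isCoprime (hτ : FormSelfAdjoint G τ) {p q : Polynomial K}
    (hpq : IsCoprime p q) {v : Fin n → V} {k l : Fin n}
    (hk : Polynomial.aeval τ p (v k) = 0) (hl : Polynomial.aeval τ q (v l) = 0) : G v = 0 := by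
  obtain ⟨a, b, hab⟩ := hpq
  have hvl : Polynomial.aeval τ (a * p) (v l) = v l := by
    have h := congrArg (fun r => Polynomial.aeval τ r (v l)) hab
    simpa [hl] using h
  have hvk : Polynomial.aeval τ (a * p) (v k) = 0 := by simp [hk]
  have h := hτ.aeval (a * p) v k l
  rw [hvl, hvk, Function.update_eq_self, MultilinearMap.map_update_zero] at h
  exact h.symm

end FormSelfAdjoint

theorem LinearMap.coe_aeval_restrict_apply {R M : Type*} [CommSemiring R] [AddCommMonoid M]
    [Module R M] {f : Module.End R M} {U : Submodule R M} (hU : ∀ x ∈ U, f x ∈ U)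
    (p : Polynomial R) (x : U) :
    (Polynomial.aeval (f.restrict hU) p x : M) = Polynomial.aeval f p (x : M) := by
  induction p using Polynomial.induction_on generalizing x with
  | C a => simp
  | add p q hp hq => simp [hp, hq]
  | monomial m a ih =>
    rw [pow_succ, ← mul_assoc, map_mul (Polynomial.aeval f),
      map_mul (Polynomial.aeval (f.restrict hU)), Polynomial.aeval_X, Polynomial.aeval_X,
      Module.End.mul_apply, Module.End.mul_apply, ih, LinearMap.coe_restrict_apply]

theorem LinearMap.aeval_minpoly_restrict_apply {K V : Type*} [Field K] [AddCommGroup V]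
    [Module K V] {f : Module.End K V} {U : Submodule K V} (hU : ∀ x ∈ U, f x ∈ U) {x : V}
    (hx : x ∈ U) : Polynomial.aeval f (minpoly K (f.restrict hU)) x = 0 := by
  rw [← LinearMap.coe_aeval_restrict_apply hU _ ⟨x, hx⟩, minpoly.aeval]
  rfl

/-- Lemma 2: if `τ` is `G`-selfadjoint and `V = V₁ ⊕ ⋯ ⊕ V_s` is a direct sum of
`τ`-invariant subspaces whose restrictions have pairwise coprime minimal polynomials
(no common eigenvalues in an algebraic closure), then `G = G₁ ⊕ ⋯ ⊕ G_s`: the form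
vanishes on any tuple whose entries lie in summands that are not all equal. -/
theorem stmt_5 {K : Type*} [Field K] {n : ℕ} (hn : 2 ≤ n)
    {V : Type*} [AddCommGroup V] [Module K V] [FiniteDimensional K V]
    (G : MultilinearMap K (fun _ : Fin n => V) K)
    (τ : V →ₗ[K] V) (hτ : FormSelfAdjoint G τ)
    {s : ℕ} (W : Fin s → Submodule K V)
    (hint : DirectSum.IsInternal W)
    (hinv : ∀ i, ∀ x ∈ W i, τ x ∈ W i)
    (hcop : ∀ i j, i ≠ j →
      IsCoprime (minpoly K (τ.restrict (hinv i))) (minpoly K (τ.restrict (hinv j)))) :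
    ∀ (v : Fin n → V) (idx : Fin n → Fin s),
      (∀ k, v k ∈ W (idx k)) → (∃ k l, idx k ≠ idx l) → G v = 0 := by
  rintro v idx hv ⟨k, l, hkl⟩
  exact hτ.apply_eq_zero_of_isCoprime (hcop _ _ hkl)
    (LinearMap.aeval_minpoly_restrict_apply (hinv _) (hv k))
    (LinearMap.aeval_minpoly_restrict_apply (hinv _) (hv l))
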